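/- Let (V, Ω, λ) be a cosymplectic vector space, i.e. V is a finite-dimensional real vector space, Ω an alternating bilinear form with dim ker Ω = 1, and λ a linear functional with ker Ω ∩ ker λ = {0}. Let S ⊆ ker λ be a subspace. Then ker Ω ∩ (S ∩ S^Ω) = {0} and S^Ω ∩ S^{ΩΩ} = (S ∩ S^Ω) ⊕ ker Ω (internal direct sum). -/

import Mathlib

variable {V : Type*} [AddCommGroup V] [Module ℝ V]

/-- The orthogonal of a subspace `S` with respect to a bilinear form `Ω`:
`S^Ω = {v ∈ V : Ω(v,s) = 0 for all s ∈ S}`. -/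
def biOrtho (Ω : V →ₗ[ℝ] V →ₗ[ℝ] ℝ) (S : Submodule ℝ V) : Submodule ℝ V where
  carrier := {v | ∀ s ∈ S, Ω v s = 0}
  add_mem' := by
    intro a b ha hb s hs
    simp [map_add, LinearMap.add_apply, ha s hs, hb s hs]
  zero_mem' := by intro s hs; simp
  smul_mem' := by
    intro c a ha s hs
    simp [map_smul, LinearMap.smul_apply, ha s hs]

/-- The kernel of a bilinear form `Ω`: `ker Ω = {v ∈ V : Ω(v,w) = 0 for all w ∈ V}`. -/
def kerB (Ω : V →ₗ[ℝ] V →ₗ[ℝ] ℝ) : Submodule ℝ V := biOrtho Ω ⊤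

/-- The polycosymplectic orthogonal of `S` with respect to a family of bilinear
forms: `S^cω = {v ∈ V : ωᵃ(v,s) = 0 for all s ∈ S and all a}`. -/
def cOrtho {k : ℕ} (ω : Fin k → V →ₗ[ℝ] V →ₗ[ℝ] ℝ) (S : Submodule ℝ V) : Submodule ℝ V :=
  ⨅ a, biOrtho (ω a) S

theorem mem_kerB {Ω : V →ₗ[ℝ] V →ₗ[ℝ] ℝ} {v : V} : v ∈ kerB Ω ↔ ∀ w, Ω v w = 0 :=
  ⟨fun h w => h w trivial, fun h w _ => h w⟩

theorem kerB_le_biOrtho (Ω : V →ₗ[ℝ] V →ₗ[ℝ] ℝ) (S : Submodule ℝ V) :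
    kerB Ω ≤ biOrtho Ω S := fun _ hv s _ => hv s trivial

/-- For an alternating form on a finite-dimensional space, the double orthogonal of a subspace
is its sum with the kernel. -/
theorem biOrtho_biOrtho [FiniteDimensional ℝ V] {Ω : V →ₗ[ℝ] V →ₗ[ℝ] ℝ} (hΩ : Ω.IsAlt)
    (S : Submodule ℝ V) : biOrtho Ω (biOrtho Ω S) = S ⊔ kerB Ω := by
  apply le_antisymm
  · intro v hv
    have hmem : Ω v ∈ (S.map Ω).dualCoannihilator.dualAnnihilator := by
      rw [Submodule.mem_dualAnnihilator]
      intro w hw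
      rw [Submodule.mem_dualCoannihilator] at hw
      exact hv w fun s hs => hΩ.isRefl _ _ (hw (Ω s) (Submodule.mem_map_of_mem hs))
    rw [Subspace.dualCoannihilator_dualAnnihilator_eq] at hmem
    obtain ⟨s, hs, hsv⟩ := hmem
    refine Submodule.mem_sup.2 ⟨s, hs, v - s, mem_kerB.2 fun w => ?_, by abel⟩
    simp [hsv]
  · exact sup_le (fun s hs t ht => hΩ.isRefl _ _ (ht s hs)) (kerB_le_biOrtho Ω _)

/-- For a cosymplectic vector space (V, Ω, λ) (dim ker Ω = 1 and
ker Ω ∩ ker λ = {0}) and a subspace S ⊆ ker λ, one has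
ker Ω ∩ (S ∩ S^Ω) = {0} and S^Ω ∩ S^ΩΩ = (S ∩ S^Ω) ⊕ ker Ω. -/
theorem cosymplectic_reduction_linear
    [FiniteDimensional ℝ V]
    (Ω : V →ₗ[ℝ] V →ₗ[ℝ] ℝ) (hΩalt : ∀ v, Ω v v = 0)
    (hker : Module.finrank ℝ ↥(kerB Ω) = 1)
    (lam : V →ₗ[ℝ] ℝ) (hlam : kerB Ω ⊓ LinearMap.ker lam = ⊥)
    (S : Submodule ℝ V) (hS : S ≤ LinearMap.ker lam) :
    kerB Ω ⊓ (S ⊓ biOrtho Ω S) = ⊥ ∧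
    biOrtho Ω S ⊓ biOrtho Ω (biOrtho Ω S) = (S ⊓ biOrtho Ω S) ⊔ kerB Ω := by
  constructor
  · rw [eq_bot_iff, ← hlam]
    exact inf_le_inf_left _ (inf_le_left.trans hS)
  · rw [biOrtho_biOrtho hΩalt, inf_comm S, inf_sup_assoc_of_le S (kerB_le_biOrtho Ω S)]
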